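/- Simulation lemma with function approximation: Let X and A be finite nonempty sets, γ ∈ (0,1), ε > 0, and V_0 > 0. For each a ∈ A let r^a ∈ ℝ^X, and let P^a and P̂^a be row-stochastic X×X matrices such that for every (x,a) ∈ X × A, ∑_{y∈X} |P̂^a(x,y) − P^a(x,y)| ≤ ε·(1−γ)/(γ·V_0). Let π : X × A → [0,1] be a stationary policy (∑_a π(x,a) = 1, π(x,a) ≥ 0), and let M be an X×X real matrix with ℓ∞ operator norm at most 1. Suppose v ∈ ℝ^X satisfies v = M·( ∑_a π(·,a)·( r^a + γ·P^a v ) ), suppose v̂ ∈ ℝ^X satisfies v̂ = M·( ∑_a π(·,a)·( r^a + γ·P̂^a v̂ ) ), and suppose ‖v‖∞ ≤ V_0. Then ‖v̂ − v‖∞ ≤ ε. -/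

import Mathlib

/-- The max-norm `‖v‖∞ = max_x |v x|` of a vector over a finite nonempty index set. -/
noncomputable def maxNorm {X : Type*} [Fintype X] [Nonempty X] (v : X → ℝ) : ℝ :=
  Finset.univ.sup' Finset.univ_nonempty fun x => |v x|

theorem abs_apply_le_maxNorm {X : Type*} [Fintype X] [Nonempty X] (v : X → ℝ) (x : X) :
    |v x| ≤ maxNorm v :=
  Finset.le_sup' (fun x => |v x|) (Finset.mem_univ x)

theorem maxNorm_le {X : Type*} [Fintype X] [Nonempty X] {v : X → ℝ} {B : ℝ}
    (h : ∀ x, |v x| ≤ B) : maxNorm v ≤ B :=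
  Finset.sup'_le _ _ fun x _ => h x

theorem abs_sum_mul_le {ι : Type*} [Fintype ι] (w f : ι → ℝ) {B : ℝ}
    (h : ∀ i, |f i| ≤ B) : |∑ i, w i * f i| ≤ (∑ i, |w i|) * B := by
  rw [Finset.sum_mul]
  refine (Finset.abs_sum_le_sum_abs _ _).trans (Finset.sum_le_sum fun i _ => ?_)
  rw [abs_mul]
  exact mul_le_mul_of_nonneg_left (h i) (abs_nonneg _)

theorem abs_mulVec_sub_mulVec_le {X : Type*} [Fintype X] [Nonempty X] {P Q : Matrix X X ℝ}
    (hQ0 : ∀ x y, 0 ≤ Q x y) (hQ1 : ∀ x, ∑ y, Q x y = 1) {c V : ℝ} (hV : 0 ≤ V)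
    {v w : X → ℝ} (hv : maxNorm v ≤ V) {x : X} (hc : ∑ y, |Q x y - P x y| ≤ c) :
    |Q.mulVec w x - P.mulVec v x| ≤ maxNorm (w - v) + c * V := by
  have hsplit : Q.mulVec w x - P.mulVec v x =
      (∑ y, Q x y * (w - v) y) + ∑ y, (Q x y - P x y) * v y := by
    simp only [Matrix.mulVec, dotProduct, ← Finset.sum_add_distrib, ← Finset.sum_sub_distrib,
      Pi.sub_apply]
    exact Finset.sum_congr rfl fun y _ => by ring
  have hQ := abs_sum_mul_le (Q x) (w - v) (abs_apply_le_maxNorm (w - v))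
  simp only [abs_of_nonneg (hQ0 x _), hQ1, one_mul] at hQ
  have hPQ := abs_sum_mul_le (fun y => Q x y - P x y) v
    fun y => (abs_apply_le_maxNorm v y).trans hv
  rw [hsplit]
  exact (abs_add_le _ _).trans
    (add_le_add hQ (hPQ.trans (mul_le_mul_of_nonneg_right hc hV)))

/-- Simulation lemma with function approximation: if the transition
matrices of two otherwise identical FMDPs are within `L1` distance `ε(1−γ)/(γV₀)` in every
row, then the corresponding approximate policy-evaluation fixed points for any policy `π`
are within `ε` in max-norm. -/
theorem simulation_lemma_fapp
    {X A : Type*} [Fintype X] [Nonempty X] [Fintype A] [Nonempty A]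
    (γ ε V₀ : ℝ) (hγ0 : 0 < γ) (hγ1 : γ < 1) (hε : 0 < ε) (hV₀ : 0 < V₀)
    (r : A → X → ℝ)
    (P Phat : A → Matrix X X ℝ)
    (hP0 : ∀ a x y, 0 ≤ P a x y) (hP1 : ∀ a x, ∑ y, P a x y = 1)
    (hPhat0 : ∀ a x y, 0 ≤ Phat a x y) (hPhat1 : ∀ a x, ∑ y, Phat a x y = 1)
    (hclose : ∀ x a, ∑ y, |Phat a x y - P a x y| ≤ ε * (1 - γ) / (γ * V₀))
    (π : X → A → ℝ) (hπ0 : ∀ x a, 0 ≤ π x a) (hπ1 : ∀ x, ∑ a, π x a = 1)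
    (M : Matrix X X ℝ) (hM : ∀ x, ∑ y, |M x y| ≤ 1)
    (v : X → ℝ)
    (hv : v = M.mulVec fun x => ∑ a, π x a * (r a x + γ * (P a).mulVec v x))
    (vhat : X → ℝ)
    (hvhat : vhat = M.mulVec fun x => ∑ a, π x a * (r a x + γ * (Phat a).mulVec vhat x))
    (hvbound : maxNorm v ≤ V₀) :
    maxNorm (vhat - v) ≤ ε := by
  have hbellman : ∀ x, |∑ a, π x a * (r a x + γ * (Phat a).mulVec vhat x) -
      ∑ a, π x a * (r a x + γ * (P a).mulVec v x)| ≤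
      γ * maxNorm (vhat - v) + ε * (1 - γ) := by
    intro x
    have h := abs_sum_mul_le (π x)
      (fun a => γ * ((Phat a).mulVec vhat x - (P a).mulVec v x))
      (B := γ * maxNorm (vhat - v) + ε * (1 - γ)) fun a => by
        have h := mul_le_mul_of_nonneg_left
          (abs_mulVec_sub_mulVec_le (hPhat0 a) (hPhat1 a) hV₀.le (w := vhat) hvbound
            (hclose x a)) hγ0.le
        rw [abs_mul, abs_of_pos hγ0]
        refine h.trans_eq ?_
        field_simp
    simp only [abs_of_nonneg (hπ0 x _), hπ1, one_mul] at h
    rw [← Finset.sum_sub_distrib]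
    refine le_of_eq_of_le (congrArg _ (Finset.sum_congr rfl fun a _ => ?_)) h
    ring
  have hcontract : maxNorm (vhat - v) ≤ γ * maxNorm (vhat - v) + ε * (1 - γ) := by
    refine maxNorm_le fun x => ?_
    have h := abs_sum_mul_le (M x) _ hbellman
    have hdiff : (vhat - v) x = ∑ y, M x y *
        (∑ a, π y a * (r a y + γ * (Phat a).mulVec vhat y) -
          ∑ a, π y a * (r a y + γ * (P a).mulVec v y)) := by
      rw [Pi.sub_apply, congrFun hvhat x, congrFun hv x]
      simp only [mul_sub, Finset.sum_sub_distrib]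
      rfl
    rw [hdiff]
    exact h.trans (mul_le_of_le_one_left ((abs_nonneg _).trans (hbellman x)) (hM x))
  nlinarith
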